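/- Let f : ℂ → ℂ^N be differentiable (holomorphic) with f(ξ) ≠ 0 for all ξ, and define P(ξ) := 1 - (f(ξ) ⊗ f(ξ)†)/(f(ξ)† · f(ξ)). Then the coefficient of the first fundamental form satisfies, at every ξ, trace(∂P(ξ) * ∂̄P(ξ)) = (f′(ξ))† ⋅ (P(ξ).mulVec (f′(ξ))) / (f(ξ)† · f(ξ)), where f′ = deriv f and v† ⋅ w = ∑ l, conj (v l) * (w l). -/

import Mathlib

open Matrix Complex

attribute [local instance] Matrix.normedAddCommGroup Matrix.normedSpace

/-- Wirtinger derivative ∂u. -/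
noncomputable def wirtingerD {E : Type*} [NormedAddCommGroup E] [NormedSpace ℂ E]
    (u : ℂ → E) (z : ℂ) : E :=
  (2 : ℂ)⁻¹ • (fderiv ℝ u z 1 - Complex.I • fderiv ℝ u z Complex.I)

/-- Wirtinger derivative ∂̄u. -/
noncomputable def wirtingerDBar {E : Type*} [NormedAddCommGroup E] [NormedSpace ℂ E]
    (u : ℂ → E) (z : ℂ) : E :=
  (2 : ℂ)⁻¹ • (fderiv ℝ u z 1 + Complex.I • fderiv ℝ u z Complex.I)

/-- The rank-(N-1) projector P = 1 - (f ⊗ f†)/(f† · f). -/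
noncomputable def projP {N : ℕ} (f : ℂ → Fin N → ℂ) (ξ : ℂ) :
    Matrix (Fin N) (Fin N) ℂ :=
  1 - Matrix.of (fun j k => f ξ j * (starRingEnd ℂ) (f ξ k) /
    (∑ l, (starRingEnd ℂ) (f ξ l) * f ξ l))

/-- The real-linear map `v ↦ v • a + conj v • b`, i.e. the differential `a dz + b dz̄`. -/
noncomputable def wirtingerCLM {E : Type*} [NormedAddCommGroup E] [NormedSpace ℂ E]
    (a b : E) : ℂ →L[ℝ] E :=
  (ContinuousLinearMap.id ℝ ℂ).smulRight a + (conjCLE : ℂ →L[ℝ] ℂ).smulRight b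

section Wirtinger

variable {E : Type*} [NormedAddCommGroup E] [NormedSpace ℂ E]

theorem wirtingerCLM_apply (a b : E) (v : ℂ) :
    wirtingerCLM a b v = v • a + (starRingEnd ℂ) v • b := by
  simp [wirtingerCLM]

theorem wirtingerD_of_hasFDerivAt {u : ℂ → E} {a b : E} {z : ℂ}
    (h : HasFDerivAt u (wirtingerCLM a b) z) : wirtingerD u z = a := by
  rw [wirtingerD, h.fderiv, wirtingerCLM_apply, wirtingerCLM_apply]
  simp only [map_one, conj_I]
  match_scalars <;> norm_num

theorem wirtingerDBar_of_hasFDerivAt {u : ℂ → E} {a b : E} {z : ℂ}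
    (h : HasFDerivAt u (wirtingerCLM a b) z) : wirtingerDBar u z = b := by
  rw [wirtingerDBar, h.fderiv, wirtingerCLM_apply, wirtingerCLM_apply]
  simp only [map_one, conj_I]
  match_scalars <;> norm_num

end Wirtinger

theorem HasDerivAt.hasFDerivAt_wirtingerCLM {g : ℂ → ℂ} {g' z : ℂ} (h : HasDerivAt g g' z) :
    HasFDerivAt g (wirtingerCLM g' 0) z := by
  refine (h.hasFDerivAt.restrictScalars ℝ).congr_fderiv ?_
  ext1 v
  simp [wirtingerCLM_apply]

theorem HasDerivAt.conj_hasFDerivAt_wirtingerCLM {g : ℂ → ℂ} {g' z : ℂ}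
    (h : HasDerivAt g g' z) :
    HasFDerivAt (fun w => (starRingEnd ℂ) (g w)) (wirtingerCLM 0 ((starRingEnd ℂ) g')) z := by
  refine ((conjCLE : ℂ →L[ℝ] ℂ).hasFDerivAt.comp z
    (h.hasFDerivAt.restrictScalars ℝ)).congr_fderiv ?_
  ext1 v
  simp [wirtingerCLM_apply]

open scoped ComplexOrder in
theorem sum_conj_mul_self_ne_zero {N : ℕ} {v : Fin N → ℂ} (hv : v ≠ 0) :
    ∑ l, (starRingEnd ℂ) (v l) * v l ≠ 0 :=
  fun h => hv (dotProduct_star_self_eq_zero.1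
    (by simpa [dotProduct, mul_comm] using h))

theorem hasFDerivAt_sum_conj_mul_self {N : ℕ} {f : ℂ → Fin N → ℂ} {f' : Fin N → ℂ} {z : ℂ}
    (hf : ∀ j, HasDerivAt (fun w => f w j) (f' j) z) :
    HasFDerivAt (fun w => ∑ l, (starRingEnd ℂ) (f w l) * f w l)
      (wirtingerCLM (∑ l, (starRingEnd ℂ) (f z l) * f' l)
        (∑ l, (starRingEnd ℂ) (f' l) * f z l)) z := by
  refine (HasFDerivAt.fun_sum fun l _ => (hf l).conj_hasFDerivAt_wirtingerCLM.mul
    (hf l).hasFDerivAt_wirtingerCLM).congr_fderiv ?_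
  ext1 v
  simp only [_root_.sum_apply, _root_.add_apply,
    _root_.smul_apply, wirtingerCLM_apply, smul_eq_mul, Finset.mul_sum,
    ← Finset.sum_add_distrib]
  exact Finset.sum_congr rfl fun l _ => by ring

theorem hasFDerivAt_projP {N : ℕ} {f : ℂ → Fin N → ℂ} {f' : Fin N → ℂ} {z : ℂ}
    (hf : ∀ j, HasDerivAt (fun w => f w j) (f' j) z) (hne : f z ≠ 0) :
    HasFDerivAt (projP f)
      (wirtingerCLM
        (Matrix.of fun j k => -(((∑ l, (starRingEnd ℂ) (f z l) * f z l) * f' j -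
          (∑ l, (starRingEnd ℂ) (f z l) * f' l) * f z j) * (starRingEnd ℂ) (f z k)) /
            (∑ l, (starRingEnd ℂ) (f z l) * f z l) ^ 2)
        (Matrix.of fun j k => -(f z j * ((∑ l, (starRingEnd ℂ) (f z l) * f z l) *
          (starRingEnd ℂ) (f' k) -
            (∑ l, (starRingEnd ℂ) (f' l) * f z l) * (starRingEnd ℂ) (f z k))) /
            (∑ l, (starRingEnd ℂ) (f z l) * f z l) ^ 2)) z := by
  have hs := sum_conj_mul_self_ne_zero hne
  refine hasFDerivAt_pi'' fun j => hasFDerivAt_pi'' fun k => ?_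
  have hinv := (hasDerivAt_inv hs).hasFDerivAt.restrictScalars ℝ |>.comp z
    (hasFDerivAt_sum_conj_mul_self hf)
  have h := (((hf j).hasFDerivAt_wirtingerCLM.mul
    (hf k).conj_hasFDerivAt_wirtingerCLM).mul hinv).const_sub
      ((1 : Matrix (Fin N) (Fin N) ℂ) j k)
  refine h.congr_fderiv ?_
  ext1 v
  change _ = (wirtingerCLM _ _ v : Matrix (Fin N) (Fin N) ℂ) j k
  rw [wirtingerCLM_apply]
  simp [wirtingerCLM_apply]
  field_simp
  ring

theorem first_fundamental_form_coefficient (N : ℕ) (f : ℂ → Fin N → ℂ)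
    (hf : Differentiable ℂ f) (hne : ∀ ξ, f ξ ≠ 0) (ξ : ℂ) :
    (wirtingerD (projP f) ξ * wirtingerDBar (projP f) ξ).trace =
      (∑ l, (starRingEnd ℂ) (deriv f ξ l) *
          ((projP f ξ).mulVec (deriv f ξ) l)) /
        (∑ l, (starRingEnd ℂ) (f ξ l) * f ξ l) := by
  have hP := hasFDerivAt_projP (hasDerivAt_pi.1 (hf ξ).hasDerivAt) (hne ξ)
  have hs := sum_conj_mul_self_ne_zero (hne ξ)
  rw [wirtingerD_of_hasFDerivAt hP, wirtingerDBar_of_hasFDerivAt hP]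
  have hmul : ∀ l, (projP f ξ).mulVec (deriv f ξ) l = deriv f ξ l - f ξ l *
      (∑ k, (starRingEnd ℂ) (f ξ k) * deriv f ξ k) /
        (∑ k, (starRingEnd ℂ) (f ξ k) * f ξ k) := by
    intro l
    rw [projP, Matrix.sub_mulVec, Matrix.one_mulVec, Pi.sub_apply]
    congr 1
    simp only [Matrix.mulVec, dotProduct, Matrix.of_apply, Finset.mul_sum, Finset.sum_div]
    exact Finset.sum_congr rfl fun k _ => by ring
  simp only [hmul, Matrix.trace, Matrix.diag_apply, Matrix.mul_apply, Matrix.of_apply]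
  generalize deriv f ξ = g
  generalize f ξ = v at hs ⊢
  set s := ∑ l, (starRingEnd ℂ) (v l) * v l with hs_def
  set a := ∑ l, (starRingEnd ℂ) (v l) * g l with ha_def
  set b := ∑ l, (starRingEnd ℂ) (g l) * v l with hb_def
  have hrow : ∀ j, ∑ k, -((s * g j - a * v j) * (starRingEnd ℂ) (v k)) / s ^ 2 *
      (-(v k * (s * (starRingEnd ℂ) (g j) - b * (starRingEnd ℂ) (v j))) / s ^ 2) =
      (starRingEnd ℂ) (g j) * g j / s - a / s ^ 2 * ((starRingEnd ℂ) (g j) * v j) -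
        b / s ^ 2 * ((starRingEnd ℂ) (v j) * g j) +
        a * b / s ^ 3 * ((starRingEnd ℂ) (v j) * v j) := by
    intro j
    trans ((s * g j - a * v j) * (s * (starRingEnd ℂ) (g j) - b * (starRingEnd ℂ) (v j))) /
      s ^ 4 * s
    · conv_rhs => rw [hs_def, Finset.mul_sum, ← hs_def]
      exact Finset.sum_congr rfl fun k _ => by ring
    · field_simp
      ring
  have hcol : ∀ l, (starRingEnd ℂ) (g l) * (g l - v l * a / s) =
      (starRingEnd ℂ) (g l) * g l - a / s * ((starRingEnd ℂ) (g l) * v l) :=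
    fun l => by ring
  simp only [hrow, hcol, Finset.sum_add_distrib, Finset.sum_sub_distrib, ← Finset.mul_sum,
    ← Finset.sum_div, ← hs_def, ← ha_def, ← hb_def]
  field_simp
  ring
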